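/- Step (iv), inherited integrability: Under the hypotheses of Step (iii) (L^{αβ}_A symmetric first-order functions satisfying (int1) and (int2), V^0 a first-order function with ∂^0_A V^0 = (1/2) L^{00}_A and (∂^i_A ∂^j_B + ∂^j_A ∂^i_B) V^0 = T^{ij}_{AB}, and G^i_A = L^{0i}_A − ∂^i_A V^0), the functions L̃^{ij}_A = L^{ij}_A − ∫_0^1 Σ_C ψ^C_0 [((∂^i_A G^j_C + ∂^j_A G^i_C)) ∘ φ_s] ds satisfy equations (int1) and (int2) with all free indices restricted to the latin range {1,…,n}. -/

import Mathlib

/-!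
Step (iv), inherited integrability: under the hypotheses of Step (iii), the
functions
`L̃^{ij}_A = L^{ij}_A − ∫₀¹ Σ_C ψᶜ₀ [(∂ⁱ_A Gʲ_C + ∂ʲ_A Gⁱ_C) ∘ φ_s] ds`
satisfy (int1) and (int2) with all free indices restricted to the latin
range `{1,…,n}` (realized via `Fin.succ`).
-/

/-- The first-order jet-type space with `n+1` base indices:
`J = ℝ^{n+1} × ℝ^N × ℝ^{N×(n+1)}`. -/
abbrev J (n N : ℕ) : Type :=
  (Fin (n+1) → ℝ) × (Fin N → ℝ) × (Fin N → Fin (n+1) → ℝ)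

/-- `∂ᵅ_A f`: the partial derivative with respect to the variable `ψᴬ_α`. -/
noncomputable def pd {n N : ℕ} (A : Fin N) (α : Fin (n+1)) (f : J n N → ℝ) :
    J n N → ℝ :=
  fun p => fderiv ℝ f p (0, 0, Pi.single A (Pi.single α (1 : ℝ)))

/-- `φ_s : J → J`, fixing all coordinates except `ψᴬ₀ ↦ s ψᴬ₀`. -/
def phi {n N : ℕ} (s : ℝ) (p : J n N) : J n N :=
  (p.1, p.2.1, fun A α => if α = 0 then s * p.2.2 A α else p.2.2 A α)

/-- `T^{ij}_{AB} = ∂ⁱ_B L^{0j}_A + ∂ʲ_B L^{0i}_A − ∂⁰_A L^{ij}_B`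
(latin indices `i, j` are the indices `1,…,n`, realized via `Fin.succ`). -/
noncomputable def Tc {n N : ℕ}
    (L : Fin (n+1) → Fin (n+1) → Fin N → J n N → ℝ)
    (i j : Fin n) (A B : Fin N) : J n N → ℝ :=
  fun p => pd B i.succ (L 0 j.succ A) p + pd B j.succ (L 0 i.succ A) p
    - pd A 0 (L i.succ j.succ B) p

/-- `Gⁱ_A = L^{0i}_A − ∂ⁱ_A V⁰`. -/
noncomputable def Gc {n N : ℕ}
    (L : Fin (n+1) → Fin (n+1) → Fin N → J n N → ℝ) (V0 : J n N → ℝ)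
    (i : Fin n) (A : Fin N) : J n N → ℝ :=
  fun p => L 0 i.succ A p - pd A i.succ V0 p

/-- `L̃^{ij}_A = L^{ij}_A − ∫₀¹ Σ_C ψᶜ₀ [(∂ⁱ_A Gʲ_C + ∂ʲ_A Gⁱ_C) ∘ φ_s] ds`. -/
noncomputable def Lt {n N : ℕ}
    (L : Fin (n+1) → Fin (n+1) → Fin N → J n N → ℝ) (V0 : J n N → ℝ)
    (i j : Fin n) (A : Fin N) : J n N → ℝ :=
  fun p => L i.succ j.succ A p - ∫ s in (0:ℝ)..1, ∑ C, p.2.2 C 0 *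
    ((fun q => pd A i.succ (Gc L V0 j C) q + pd A j.succ (Gc L V0 i C) q)
      (phi s p))

/-- Smoothness is preserved by the partial derivatives `∂ᵅ_A`. -/
theorem contDiff_pd {n N : ℕ} {f : J n N → ℝ} (hf : ContDiff ℝ (⊤ : ℕ∞) f)
    (A : Fin N) (α : Fin (n+1)) : ContDiff ℝ (⊤ : ℕ∞) (pd A α f) :=
  (hf.fderiv_right (m := (⊤ : ℕ∞)) (by simp)).clm_apply contDiff_const

theorem pd_sub {n N : ℕ} {f g : J n N → ℝ} (hf : Differentiable ℝ f)
    (hg : Differentiable ℝ g) (A : Fin N) (α : Fin (n+1)) (p : J n N) :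
    pd A α (fun q => f q - g q) p = pd A α f p - pd A α g p := by
  simp only [pd]
  rw [fderiv_fun_sub (hf p) (hg p)]
  rfl

/-- Partial derivatives of a smooth function commute. -/
theorem pd_comm {n N : ℕ} {f : J n N → ℝ} (hf : ContDiff ℝ (⊤ : ℕ∞) f)
    (A B : Fin N) (α β : Fin (n+1)) (p : J n N) :
    pd A α (pd B β f) p = pd B β (pd A α f) p := by
  have hd : Differentiable ℝ (fderiv ℝ f) :=
    (hf.fderiv_right (m := (⊤ : ℕ∞)) (by simp)).differentiable (by simp)
  have hsymm : IsSymmSndFDerivAt ℝ f p :=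
    hf.contDiffAt.isSymmSndFDerivAt (by
      rw [minSmoothness_of_isRCLikeNormedField]
      exact WithTop.coe_le_coe.mpr le_top)
  have key : ∀ v w : J n N,
      fderiv ℝ (fun q => fderiv ℝ f q v) p w = fderiv ℝ (fderiv ℝ f) p w v := by
    intro v w
    rw [fderiv_clm_apply (hd p) (differentiableAt_const v)]
    simp
  unfold pd
  rw [key, key]
  exact hsymm _ _

/-- `φ_s` as a continuous linear map. -/
noncomputable def phiCLM (n N : ℕ) (s : ℝ) : J n N →L[ℝ] J n N :=
  LinearMap.toContinuousLinearMap
    { toFun := phi s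
      map_add' := by
        intro p q
        refine Prod.ext rfl (Prod.ext rfl ?_)
        funext A α
        by_cases h : α = 0 <;> simp [phi, h, mul_add]
      map_smul' := by
        intro c p
        refine Prod.ext rfl (Prod.ext rfl ?_)
        funext A α
        by_cases h : α = 0 <;> simp [phi, h, mul_left_comm] }

theorem phiCLM_apply {n N : ℕ} (s : ℝ) (p : J n N) : phiCLM n N s p = phi s p := rfl

/-- Latin derivatives commute with pullback along `φ_s`. -/
theorem pd_succ_comp_phi {n N : ℕ} {f : J n N → ℝ} (hf : Differentiable ℝ f)
    (s : ℝ) (A : Fin N) (i : Fin n) (p : J n N) :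
    pd A i.succ (fun q => f (phi s q)) p = pd A i.succ f (phi s p) := by
  have hfix : phiCLM n N s (0, 0, Pi.single A (Pi.single i.succ (1 : ℝ))) =
      (0, 0, Pi.single A (Pi.single i.succ (1 : ℝ))) := by
    rw [phiCLM_apply]
    refine Prod.ext rfl (Prod.ext rfl ?_)
    funext B α
    by_cases h : α = 0
    · subst h
      by_cases hB : B = A
      · subst hB; simp [phi]
      · simp [phi, hB]
    · simp [phi, h]
  have hcomp : HasFDerivAt (fun q => f (phi s q))
      ((fderiv ℝ f (phi s p)).comp (phiCLM n N s)) p :=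
    (hf (phi s p)).hasFDerivAt.comp p (phiCLM n N s).hasFDerivAt
  simp only [pd]
  rw [hcomp.fderiv, ContinuousLinearMap.comp_apply, hfix]

theorem phi_one {n N : ℕ} (p : J n N) : phi 1 p = p := by
  simp [phi]

theorem phi_eq_add_smul {n N : ℕ} (s : ℝ) (p : J n N) :
    phi s p = phi 0 p + s • ∑ C, p.2.2 C 0 •
      ((0, 0, Pi.single C (Pi.single 0 (1 : ℝ))) : J n N) := by
  refine Prod.ext ?_ (Prod.ext ?_ ?_)
  · simp [phi, Prod.fst_sum]
  · simp [phi, Prod.fst_sum, Prod.snd_sum]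
  · funext A α
    by_cases h : α = 0
    · subst h
      simp [phi, Prod.snd_sum, Finset.sum_apply, Pi.single_apply]
    · simp [phi, Prod.snd_sum, Finset.sum_apply, Pi.single_apply, h]

theorem hasDerivAt_comp_phi {n N : ℕ} {f : J n N → ℝ} (hf : Differentiable ℝ f)
    (p : J n N) (s : ℝ) :
    HasDerivAt (fun t => f (phi t p)) (∑ C, p.2.2 C 0 * pd C 0 f (phi s p)) s := by
  have hphi : HasDerivAt (fun t => phi t p)
      (∑ C, p.2.2 C 0 • ((0, 0, Pi.single C (Pi.single 0 (1 : ℝ))) : J n N)) s := by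
    rw [funext fun t => phi_eq_add_smul t p]
    simpa using ((hasDerivAt_id s).smul_const (∑ C, p.2.2 C 0 •
      ((0, 0, Pi.single C (Pi.single 0 (1 : ℝ))) : J n N))).const_add (phi 0 p)
  have h := (hf (phi s p)).hasFDerivAt.comp_hasDerivAt s hphi
  simp only [map_sum, map_smul, smul_eq_mul] at h
  exact h

theorem continuous_phi_left {n N : ℕ} (p : J n N) : Continuous fun s => phi s p := by
  rw [funext fun s => phi_eq_add_smul s p]
  fun_prop

/-- The fundamental theorem of calculus along the rays `s ↦ φ_s p`. -/
theorem integral_pd_zero_comp_phi {n N : ℕ} {f : J n N → ℝ}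
    (hf : ContDiff ℝ (⊤ : ℕ∞) f) (p : J n N) :
    ∫ s in (0:ℝ)..1, ∑ C, p.2.2 C 0 * pd C 0 f (phi s p) = f p - f (phi 0 p) := by
  have hcont : Continuous fun s => ∑ C, p.2.2 C 0 * pd C 0 f (phi s p) :=
    continuous_finsetSum _ fun C _ => continuous_const.mul
      ((contDiff_pd hf C 0).continuous.comp (continuous_phi_left p))
  rw [intervalIntegral.integral_eq_sub_of_hasDerivAt
    (fun s _ => hasDerivAt_comp_phi (hf.differentiable (by simp)) p s)
    (hcont.intervalIntegrable _ _), phi_one]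

/-- The equations for `V⁰` say that `∂ⁱ_A Gʲ_C + ∂ʲ_A Gⁱ_C` is `∂⁰_C L^{ij}_A`. -/
theorem pd_Gc_symm_eq_pd_zero {n N : ℕ}
    {L : Fin (n+1) → Fin (n+1) → Fin N → J n N → ℝ}
    (hL : ∀ α β A, ContDiff ℝ (⊤ : ℕ∞) (L α β A))
    {V0 : J n N → ℝ} (hV : ContDiff ℝ (⊤ : ℕ∞) V0)
    (hT : ∀ (i j : Fin n) (A B : Fin N) (p : J n N),
      pd A i.succ (pd B j.succ V0) p + pd A j.succ (pd B i.succ V0) p =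
      Tc L i j A B p)
    (i j : Fin n) (A C : Fin N) (p : J n N) :
    pd A i.succ (Gc L V0 j C) p + pd A j.succ (Gc L V0 i C) p =
      pd C 0 (L i.succ j.succ A) p := by
  have hG : ∀ a b : Fin n, pd A a.succ (Gc L V0 b C) p =
      pd A a.succ (L 0 b.succ C) p - pd A a.succ (pd C b.succ V0) p := fun a b =>
    pd_sub ((hL _ _ _).differentiable (by simp))
      ((contDiff_pd hV _ _).differentiable (by simp)) _ _ _
  have h := hT i j C A p
  rw [pd_comm hV C A, pd_comm hV C A] at h
  simp only [Tc] at h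
  rw [hG, hG]
  linarith

/-- The functions `L̃^{ij}_A` are the restrictions of `L^{ij}_A` to `ψ₀ = 0`. -/
theorem Lt_eq_comp_phi_zero {n N : ℕ}
    {L : Fin (n+1) → Fin (n+1) → Fin N → J n N → ℝ}
    (hL : ∀ α β A, ContDiff ℝ (⊤ : ℕ∞) (L α β A))
    {V0 : J n N → ℝ} (hV : ContDiff ℝ (⊤ : ℕ∞) V0)
    (hT : ∀ (i j : Fin n) (A B : Fin N) (p : J n N),
      pd A i.succ (pd B j.succ V0) p + pd A j.succ (pd B i.succ V0) p =
      Tc L i j A B p)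
    (i j : Fin n) (A : Fin N) :
    Lt L V0 i j A = fun p => L i.succ j.succ A (phi 0 p) := by
  funext p
  simp only [Lt, pd_Gc_symm_eq_pd_zero hL hV hT, integral_pd_zero_comp_phi (hL _ _ _)]
  ring

theorem step_iv_integrability (n N : ℕ) (hn : 0 < n) (hN : 0 < N)
    (L : Fin (n+1) → Fin (n+1) → Fin N → J n N → ℝ)
    (hLsmooth : ∀ α β A, ContDiff ℝ (⊤ : ℕ∞) (L α β A))
    (hLsym : ∀ α β A, L α β A = L β α A)
    (hint1 : ∀ (μ ν ρ : Fin (n+1)) (A B : Fin N) (p : J n N),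
      pd B ρ (L μ ν A) p + pd B μ (L ρ ν A) p + pd B ν (L μ ρ A) p =
      pd A ρ (L μ ν B) p + pd A μ (L ρ ν B) p + pd A ν (L μ ρ B) p)
    (hint2 : ∀ (μ ν ρ σ : Fin (n+1)) (A B C : Fin N) (p : J n N),
      pd B μ (fun q => pd C ρ (L σ ν A) q + pd C σ (L ρ ν A) q) p
      + pd B ν (fun q => pd C ρ (L σ μ A) q + pd C σ (L ρ μ A) q) p
      - (pd A μ (pd B ν (L σ ρ C)) p + pd A ν (pd B μ (L σ ρ C)) p)
      - (pd A ρ (pd C σ (L μ ν B)) p + pd A σ (pd C ρ (L μ ν B)) p) = 0)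
    (V0 : J n N → ℝ) (hV0smooth : ContDiff ℝ (⊤ : ℕ∞) V0)
    (hV01 : ∀ (A : Fin N) (p : J n N), pd A 0 V0 p = (1/2) * L 0 0 A p)
    (hV02 : ∀ (i j : Fin n) (A B : Fin N) (p : J n N),
      pd A i.succ (pd B j.succ V0) p + pd A j.succ (pd B i.succ V0) p =
      Tc L i j A B p) :
    (∀ (i j k : Fin n) (A B : Fin N) (p : J n N),
      pd B k.succ (Lt L V0 i j A) p + pd B i.succ (Lt L V0 k j A) p
        + pd B j.succ (Lt L V0 i k A) p =
      pd A k.succ (Lt L V0 i j B) p + pd A i.succ (Lt L V0 k j B) p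
        + pd A j.succ (Lt L V0 i k B) p) ∧
    (∀ (i j k l : Fin n) (A B C : Fin N) (p : J n N),
      pd B i.succ (fun q => pd C k.succ (Lt L V0 l j A) q
          + pd C l.succ (Lt L V0 k j A) q) p
      + pd B j.succ (fun q => pd C k.succ (Lt L V0 l i A) q
          + pd C l.succ (Lt L V0 k i A) q) p
      - (pd A i.succ (pd B j.succ (Lt L V0 l k C)) p
          + pd A j.succ (pd B i.succ (Lt L V0 l k C)) p)
      - (pd A k.succ (pd C l.succ (Lt L V0 i j B)) p
          + pd A l.succ (pd C k.succ (Lt L V0 i j B)) p) = 0) := by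
  have hLt := Lt_eq_comp_phi_zero hLsmooth hV0smooth hV02
  have hL : ∀ α β A, Differentiable ℝ (L α β A) := fun α β A =>
    (hLsmooth α β A).differentiable (by simp)
  have hpdL : ∀ α β A B γ, Differentiable ℝ (pd B γ (L α β A)) := fun α β A B γ =>
    (contDiff_pd (hLsmooth α β A) B γ).differentiable (by simp)
  have hpd : ∀ (i j k : Fin n) (A B : Fin N),
      pd B k.succ (fun q => L i.succ j.succ A (phi 0 q)) =
        fun q => pd B k.succ (L i.succ j.succ A) (phi 0 q) := fun i j k A B =>
    funext (pd_succ_comp_phi (hL _ _ _) 0 B k)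
  refine ⟨fun i j k A B p => ?_, fun i j k l A B C p => ?_⟩
  · simp only [hLt, hpd]
    exact hint1 _ _ _ A B (phi 0 p)
  · have hsum : ∀ (a b : Fin n), pd B a.succ
        (fun q => pd C k.succ (L l.succ b.succ A) (phi 0 q)
          + pd C l.succ (L k.succ b.succ A) (phi 0 q)) p =
        pd B a.succ (fun q => pd C k.succ (L l.succ b.succ A) q
          + pd C l.succ (L k.succ b.succ A) q) (phi 0 p) := fun a b =>
      pd_succ_comp_phi ((hpdL _ _ _ _ _).add (hpdL _ _ _ _ _)) 0 B a p
    simp only [hLt, hpd, hsum, pd_succ_comp_phi (hpdL _ _ _ _ _)]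
    exact hint2 _ _ _ _ A B C (phi 0 p)
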